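/- Let d ≥ 1 be an integer, 0 < α < 2, α < d, and 0 ≤ δ ≤ (d−α)/2. Then there exists a constant C < ∞ such that for all x, y ∈ ℝ^d with 1 ≤ |y| and |y|/2 ≤ |x| ≤ |y|: ∫₀^1 ∫_{ℝ^d} s^{-d/α} (1−s)^{-d/α} · |z|^{-α} · (1 + s^{δ/α} |z|^{-δ}) · min(1, (1−s)^{1+d/α}/|x−z|^{d+α}) · min(1, s^{1+d/α}/|z−y|^{d+α}) dz ds ≤ C · ( |y|^{-(d+α)} + |x|^{-α} · min(1, |x−y|^{-(d+α)}) ). -/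

import Mathlib

open MeasureTheory Real

/-- The two-sided heat kernel profile of `|p|^α` in dimension `d`, at time `t` and distance `r`. -/
noncomputable def stableProfile (d : ℕ) (α t r : ℝ) : ℝ :=
  t ^ (-(d : ℝ) / α) * min 1 (t ^ (1 + (d : ℝ) / α) / r ^ ((d : ℝ) + α))

section
variable {d : ℕ} {α t r : ℝ}

theorem stableProfile_nonneg (ht : 0 ≤ t) (hr : 0 ≤ r) : 0 ≤ stableProfile d α t r := by
  unfold stableProfile; positivity

theorem stableProfile_le_rpow (ht : 0 ≤ t) : stableProfile d α t r ≤ t ^ (-(d : ℝ) / α) :=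
  mul_le_of_le_one_right (by positivity) (min_le_left _ _)

theorem stableProfile_le_mul_rpow_neg (ht : 0 < t) (hr : 0 ≤ r) :
    stableProfile d α t r ≤ t * r ^ (-((d : ℝ) + α)) := by
  calc stableProfile d α t r
      ≤ t ^ (-(d : ℝ) / α) * (t ^ (1 + (d : ℝ) / α) / r ^ ((d : ℝ) + α)) := by
        unfold stableProfile; gcongr; exact min_le_right _ _
    _ = t * r ^ (-((d : ℝ) + α)) := by
        rw [rpow_neg hr, div_eq_mul_inv _ (r ^ _), ← mul_assoc, ← rpow_add ht]
        ring_nf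
        simp [mul_comm]

theorem stableProfile_le_rpow_neg (hα : 0 < α) {ρ : ℝ} (ht : 0 < t) (ht1 : t ≤ 1) (hρ : 0 < ρ)
    (h : ρ ≤ r) : stableProfile d α t r ≤ ρ ^ (-((d : ℝ) + α)) := by
  have hp : -((d : ℝ) + α) ≤ 0 := by have := d.cast_nonneg (α := ℝ); linarith
  calc stableProfile d α t r ≤ t * r ^ (-((d : ℝ) + α)) :=
        stableProfile_le_mul_rpow_neg ht (hρ.le.trans h)
    _ ≤ 1 * ρ ^ (-((d : ℝ) + α)) := by
        have hr : 0 ≤ r := hρ.le.trans h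
        exact mul_le_mul ht1 (rpow_le_rpow_of_nonpos hρ h hp) (by positivity) zero_le_one
    _ = _ := one_mul _

theorem min_one_inv_rpow_le {w p : ℝ} (hw : 0 ≤ w) (hp : 0 ≤ p) :
    min 1 (1 / w ^ p) ≤ 2 ^ p * (1 + w) ^ (-p) := by
  rw [rpow_neg (by positivity), ← div_eq_mul_inv, ← div_rpow (by norm_num) (by positivity)]
  rcases le_total w 1 with h | h
  · exact (min_le_left _ _).trans
      (one_le_rpow ((one_le_div (by positivity)).2 (by linarith)) hp)
  · have hw0 : 0 < w := by linarith
    refine (min_le_right _ _).trans ?_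
    rw [← one_rpow p, ← div_rpow (by norm_num) hw, one_rpow]
    refine rpow_le_rpow (by positivity) ?_ hp
    rw [div_le_div_iff₀ hw0 (by positivity)]
    linarith

theorem stableProfile_le_scaled (hα : 0 < α) (ht : 0 < t) (hr : 0 ≤ r) :
    stableProfile d α t r ≤ t ^ (-(d : ℝ) / α) *
      (2 ^ ((d : ℝ) + α) * (1 + t ^ (-1 / α) * r) ^ (-((d : ℝ) + α))) := by
  have h : t ^ (1 + (d : ℝ) / α) / r ^ ((d : ℝ) + α)
      = 1 / (t ^ (-1 / α) * r) ^ ((d : ℝ) + α) := by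
    rw [mul_rpow (by positivity) hr, ← rpow_mul ht.le, one_div, mul_inv, ← rpow_neg ht.le,
      div_eq_mul_inv]
    congr 2
    field_simp
    ring
  unfold stableProfile
  rw [h]
  gcongr
  exact min_one_inv_rpow_le (by positivity) (by positivity)

theorem stableProfile_mul_le (hα : 0 < α) {s a b c m : ℝ} (hs0 : 0 < s) (hs1 : s < 1)
    (ha : 0 ≤ a) (hb : 0 ≤ b) (hc : c ≤ a + b)
    (hm : m = 1 ∨ 0 < c ∧ m = c ^ (-((d : ℝ) + α))) :
    stableProfile d α (1 - s) a * stableProfile d α s b ≤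
      (2 ^ ((d : ℝ) + α) + 2 ^ ((d : ℝ) / α)) * m *
        (stableProfile d α (1 - s) a + stableProfile d α s b) := by
  have hs1' : 0 < 1 - s := by linarith
  have hA := stableProfile_nonneg (d := d) (α := α) hs1'.le ha
  have hB := stableProfile_nonneg (d := d) (α := α) hs0.le hb
  set A := stableProfile d α (1 - s) a with hAdef
  set B := stableProfile d α s b with hBdef
  have h1 : (0 : ℝ) < 2 ^ ((d : ℝ) + α) := by positivity
  have h2 : (0 : ℝ) < 2 ^ ((d : ℝ) / α) := by positivity
  have hm0 : 0 < m := by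
    rcases hm with rfl | ⟨hc0, rfl⟩
    · norm_num
    · positivity
  suffices h : A ≤ (2 ^ ((d : ℝ) + α) + 2 ^ ((d : ℝ) / α)) * m ∨
      B ≤ (2 ^ ((d : ℝ) + α) + 2 ^ ((d : ℝ) / α)) * m by
    set D := (2 ^ ((d : ℝ) + α) + 2 ^ ((d : ℝ) / α)) * m
    have hD : 0 ≤ D := by positivity
    rcases h with h | h
    · nlinarith [mul_le_mul_of_nonneg_right h hB, mul_nonneg hD hA]
    · nlinarith [mul_le_mul_of_nonneg_left h hA, mul_nonneg hD hB]
  have half_time : ∀ t : ℝ, 1 / 2 ≤ t → t ^ (-(d : ℝ) / α) ≤ 2 ^ ((d : ℝ) / α) := by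
    intro t ht
    have e : (2 : ℝ) ^ ((d : ℝ) / α) = (1 / 2 : ℝ) ^ (-(d : ℝ) / α) := by
      rw [one_div, inv_rpow (by norm_num), neg_div, rpow_neg (by norm_num), inv_inv]
    rw [e]
    refine rpow_le_rpow_of_nonpos (by norm_num) ht ?_
    rw [neg_div]; simp only [Left.neg_nonpos_iff]; positivity
  rcases hm with rfl | ⟨hc0, rfl⟩
  · rcases le_total (1 / 2) s with h | h
    · right; linarith [half_time s h, stableProfile_le_rpow (d := d) (α := α) (r := b) hs0.le]
    · left
      linarith [half_time (1 - s) (by linarith),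
        stableProfile_le_rpow (d := d) (α := α) (r := a) hs1'.le]
  · have e : (c / 2) ^ (-((d : ℝ) + α)) = 2 ^ ((d : ℝ) + α) * c ^ (-((d : ℝ) + α)) := by
      rw [div_rpow hc0.le (by norm_num), rpow_neg (by norm_num : (0 : ℝ) ≤ 2), div_inv_eq_mul,
        mul_comm]
    have h3 := mul_pos h2 hm0
    rcases le_total (c / 2) a with h | h
    · left
      have := stableProfile_le_rpow_neg (d := d) hα hs1' (by linarith) (half_pos hc0) h
      rw [e] at this
      linarith
    · right
      have := stableProfile_le_rpow_neg (d := d) hα hs0 hs1.le (half_pos hc0)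
        (show c / 2 ≤ b by linarith)
      rw [e] at this
      linarith

end

theorem lintegral_one_add_norm_lt_top (d : ℕ) {α : ℝ} (hα : 0 < α) :
    ∫⁻ z : EuclideanSpace ℝ (Fin d), ENNReal.ofReal ((1 + ‖z‖) ^ (-((d : ℝ) + α))) < ⊤ :=
  finite_integral_one_add_norm (by simpa using hα)

theorem lintegral_comp_smul_euclidean {d : ℕ} {f : EuclideanSpace ℝ (Fin d) → ENNReal}
    (hf : Measurable f) {c : ℝ} (hc : 0 < c) :
    ∫⁻ z, f (c • z) = ENNReal.ofReal (c ^ (-(d : ℝ))) * ∫⁻ z, f z := by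
  rw [← lintegral_map hf (measurable_const_smul c), Measure.map_addHaar_smul volume hc.ne',
    lintegral_smul_measure, smul_eq_mul, abs_of_pos (by positivity), rpow_neg hc.le]
  simp

theorem exists_lintegral_stableProfile_le (d : ℕ) {α : ℝ} (hα : 0 < α) :
    ∃ K : ENNReal, K ≠ ⊤ ∧ ∀ t : ℝ, 0 < t →
      ∫⁻ z : EuclideanSpace ℝ (Fin d), ENNReal.ofReal (stableProfile d α t ‖z‖) ≤ K := by
  refine ⟨ENNReal.ofReal (2 ^ ((d : ℝ) + α)) * ∫⁻ z : EuclideanSpace ℝ (Fin d),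
    ENNReal.ofReal ((1 + ‖z‖) ^ (-((d : ℝ) + α))),
    ENNReal.mul_ne_top ENNReal.ofReal_ne_top (lintegral_one_add_norm_lt_top d hα).ne, ?_⟩
  intro t ht
  have hc : 0 < t ^ (-1 / α) := by positivity
  calc ∫⁻ z : EuclideanSpace ℝ (Fin d), ENNReal.ofReal (stableProfile d α t ‖z‖)
      ≤ ∫⁻ z : EuclideanSpace ℝ (Fin d), ENNReal.ofReal (t ^ (-(d : ℝ) / α) * 2 ^ ((d : ℝ) + α)) *
          ENNReal.ofReal ((1 + ‖t ^ (-1 / α) • z‖) ^ (-((d : ℝ) + α))) := by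
        refine lintegral_mono fun z => ?_
        rw [← ENNReal.ofReal_mul (by positivity), norm_smul, norm_of_nonneg hc.le, mul_assoc]
        exact ENNReal.ofReal_le_ofReal (stableProfile_le_scaled hα ht (norm_nonneg z))
    _ = _ := by
        rw [lintegral_const_mul' _ _ ENNReal.ofReal_ne_top,
          lintegral_comp_smul_euclidean
            (f := fun z => ENNReal.ofReal ((1 + ‖z‖) ^ (-((d : ℝ) + α)))) (by fun_prop) hc,
          ← mul_assoc, ← ENNReal.ofReal_mul (by positivity)]
        congr 2
        rw [← rpow_mul ht.le, mul_right_comm, ← rpow_add ht]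
        ring_nf
        simp

theorem lintegral_indicator_norm_rpow_lt_top {d : ℕ} (hd : 1 ≤ d) {β : ℝ} (hβ : β < d) :
    ∫⁻ z : EuclideanSpace ℝ (Fin d),
      ENNReal.ofReal ((Set.Ioc (0 : ℝ) 1).indicator (fun r => r ^ (-β)) ‖z‖) < ⊤ := by
  have : Nonempty (Fin d) := ⟨⟨0, hd⟩⟩
  have h : Integrable (fun z : EuclideanSpace ℝ (Fin d) =>
      (Set.Ioc (0 : ℝ) 1).indicator (fun r => r ^ (-β)) ‖z‖) := by
    rw [integrable_fun_norm_addHaar (volume : Measure (EuclideanSpace ℝ (Fin d)))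
      (f := (Set.Ioc (0 : ℝ) 1).indicator (fun r => r ^ (-β)))]
    have h1 : IntegrableOn (fun r : ℝ => r ^ ((d : ℝ) - 1 - β)) (Set.Ioc 0 1) :=
      (intervalIntegrable_iff_integrableOn_Ioc_of_le zero_le_one).1
        (intervalIntegral.intervalIntegrable_rpow' (by linarith))
    refine ((integrable_indicator_iff measurableSet_Ioc).2 h1).integrableOn.congr_fun
      (fun r hr => ?_) measurableSet_Ioi
    by_cases hr1 : r ∈ Set.Ioc (0 : ℝ) 1
    · have hr0 : 0 < r := hr1.1
      simp only [Set.indicator_of_mem hr1, finrank_euclideanSpace, Fintype.card_fin, smul_eq_mul]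
      rw [← rpow_natCast, ← rpow_add hr0, Nat.cast_sub hd]
      ring_nf
    · simp [Set.indicator_of_notMem hr1]
  exact h.lintegral_lt_top

theorem weight_le_of_le {α δ s ρ r : ℝ} (hα : 0 < α) (hδ : 0 ≤ δ) (hs0 : 0 < s) (hs1 : s < 1)
    (hρ : 0 < ρ) (hρr : ρ / 4 ≤ r) (hr : 1 / 4 ≤ r) :
    r ^ (-α) * (1 + s ^ (δ / α) * r ^ (-δ)) ≤ 4 ^ α * (1 + 4 ^ δ) * ρ ^ (-α) := by
  have h1 : r ^ (-α) ≤ 4 ^ α * ρ ^ (-α) := by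
    refine (rpow_le_rpow_of_nonpos (by positivity) hρr (by linarith)).trans_eq ?_
    rw [div_rpow hρ.le (by norm_num), rpow_neg (by norm_num : (0 : ℝ) ≤ 4), div_inv_eq_mul,
      mul_comm]
  have h2 : r ^ (-δ) ≤ 4 ^ δ := by
    refine (rpow_le_rpow_of_nonpos (by positivity) hr (by linarith)).trans_eq ?_
    rw [one_div, inv_rpow (by norm_num), rpow_neg (by norm_num), inv_inv]
  have h3 : s ^ (δ / α) ≤ 1 := rpow_le_one hs0.le hs1.le (by positivity)
  have hr0 : 0 < r := by linarith
  calc r ^ (-α) * (1 + s ^ (δ / α) * r ^ (-δ))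
      ≤ (4 ^ α * ρ ^ (-α)) * (1 + 1 * 4 ^ δ) := by gcongr
    _ = _ := by ring

theorem weight_le {α δ s r : ℝ} (hα : 0 < α) (hδ : 0 ≤ δ) (hs0 : 0 < s) (hs1 : s < 1)
    (hr : 0 ≤ r) :
    r ^ (-α) * (1 + s ^ (δ / α) * r ^ (-δ)) ≤
      2 * max ((Set.Ioc (0 : ℝ) 1).indicator (fun r => r ^ (-(α + δ))) r) 1 := by
  have h3 : s ^ (δ / α) ≤ 1 := rpow_le_one hs0.le hs1.le (by positivity)
  rcases hr.eq_or_lt with rfl | hr0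
  · rw [zero_rpow (by linarith), zero_mul]
    positivity
  have h4 : r ^ (-α) * (1 + s ^ (δ / α) * r ^ (-δ)) ≤ r ^ (-α) + r ^ (-(α + δ)) := by
    rw [neg_add, rpow_add hr0, mul_add, mul_one]
    have : s ^ (δ / α) * r ^ (-δ) ≤ r ^ (-δ) := mul_le_of_le_one_left (by positivity) h3
    gcongr
  refine h4.trans ?_
  rcases le_or_gt r 1 with h | h
  · rw [Set.indicator_of_mem (show r ∈ Set.Ioc (0 : ℝ) 1 from ⟨hr0, h⟩)]
    have : r ^ (-α) ≤ r ^ (-(α + δ)) := rpow_le_rpow_of_exponent_ge hr0 h (by linarith)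
    linarith [le_max_left (r ^ (-(α + δ))) 1]
  · linarith [rpow_le_one_of_one_le_of_nonpos h.le (by linarith : -α ≤ 0),
      rpow_le_one_of_one_le_of_nonpos h.le (by linarith : -(α + δ) ≤ 0),
      le_max_right ((Set.Ioc (0 : ℝ) 1).indicator (fun r => r ^ (-(α + δ))) r) 1]

theorem weight_le_of_lt {d : ℕ} {α δ s r R : ℝ} (hα : 0 < α) (hδ : 0 ≤ δ) (hs0 : 0 < s)
    (hs1 : s < 1) (hr : 0 ≤ r) (hR : 1 ≤ R) (hrR : r < R) :
    r ^ (-α) * (1 + s ^ (δ / α) * r ^ (-δ)) ≤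
      2 * (2 * R) ^ ((d : ℝ) + α) * ((Set.Ioc (0 : ℝ) 1).indicator (fun r => r ^ (-(α + δ))) r +
        (1 + r) ^ (-((d : ℝ) + α))) := by
  refine (weight_le hα hδ hs0 hs1 hr).trans ?_
  rw [mul_assoc]
  refine mul_le_mul_of_nonneg_left ?_ zero_le_two
  have hI : 0 ≤ (Set.Ioc (0 : ℝ) 1).indicator (fun r => r ^ (-(α + δ))) r :=
    Set.indicator_nonneg (fun r hr => rpow_nonneg hr.1.le _) r
  have hp : 0 ≤ (d : ℝ) + α := by positivity
  have hb : 1 ≤ (2 * R) ^ ((d : ℝ) + α) := one_le_rpow (by linarith) hp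
  have ht : 1 ≤ (2 * R) ^ ((d : ℝ) + α) * (1 + r) ^ (-((d : ℝ) + α)) := by
    rw [rpow_neg (by positivity), ← div_eq_mul_inv, ← div_rpow (by positivity) (by positivity)]
    exact one_le_rpow ((one_le_div (by positivity)).2 (by linarith)) hp
  rw [mul_add]
  apply max_le <;> nlinarith

/-- Pointwise bound on the Duhamel integrand. -/
theorem duhamel_integrand_le {d : ℕ} {α δ s m : ℝ} (hα : 0 < α) (hδ : 0 ≤ δ)
    (hs0 : 0 < s) (hs1 : s < 1) {x y : EuclideanSpace ℝ (Fin d)} (hy : 1 ≤ ‖y‖)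
    (hyx : ‖y‖ / 2 ≤ ‖x‖) (hxy : ‖x‖ ≤ ‖y‖)
    (hm : m = 1 ∨ 0 < ‖x - y‖ ∧ m = ‖x - y‖ ^ (-((d : ℝ) + α))) (z : EuclideanSpace ℝ (Fin d)) :
    ‖z‖ ^ (-α) * (1 + s ^ (δ / α) * ‖z‖ ^ (-δ)) *
        (stableProfile d α (1 - s) ‖x - z‖ * stableProfile d α s ‖z - y‖) ≤
      4 ^ α * (1 + 4 ^ δ) * (2 ^ ((d : ℝ) + α) + 2 ^ ((d : ℝ) / α)) * (‖x‖ ^ (-α) * m) *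
          (stableProfile d α (1 - s) ‖x - z‖ + stableProfile d α s ‖z - y‖) +
        2 * 32 ^ ((d : ℝ) + α) * ‖y‖ ^ (-((d : ℝ) + α)) *
          ((Set.Ioc (0 : ℝ) 1).indicator (fun r => r ^ (-(α + δ))) ‖z‖ +
            (1 + ‖z‖) ^ (-((d : ℝ) + α))) := by
  have hs1' : 0 < 1 - s := by linarith
  have hA := stableProfile_nonneg (d := d) (α := α) hs1'.le (norm_nonneg (x - z))
  have hB := stableProfile_nonneg (d := d) (α := α) hs0.le (norm_nonneg (z - y))
  have hI : 0 ≤ (Set.Ioc (0 : ℝ) 1).indicator (fun r => r ^ (-(α + δ))) ‖z‖ :=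
    Set.indicator_nonneg (fun r hr => rpow_nonneg hr.1.le _) _
  have hm0 : 0 < m := by
    rcases hm with rfl | ⟨hc0, rfl⟩
    · norm_num
    · positivity
  have hx0 : 0 < ‖x‖ := by linarith
  have hy0 : 0 < ‖y‖ := by linarith
  rcases le_or_gt (‖y‖ / 4) ‖z‖ with hz | hz
  · refine le_add_of_le_of_nonneg ?_ (by positivity)
    have hw := weight_le_of_le (ρ := ‖x‖) (r := ‖z‖) hα hδ hs0 hs1 hx0
      (by linarith) (by linarith)
    have hP := stableProfile_mul_le (d := d) hα hs0 hs1 (norm_nonneg (x - z))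
      (norm_nonneg (z - y)) (norm_sub_le_norm_sub_add_norm_sub x z y) hm
    refine (mul_le_mul hw hP (by positivity) (by positivity)).trans_eq ?_
    ring
  · refine le_add_of_nonneg_of_le (by positivity) ?_
    have hw := weight_le_of_lt (d := d) (r := ‖z‖) hα hδ hs0 hs1 (norm_nonneg z) hy
      (by linarith)
    have h1 := stableProfile_le_rpow_neg (d := d) (ρ := ‖y‖ / 4) (r := ‖x - z‖) hα hs1'
      (by linarith) (by linarith) (by linarith [norm_sub_norm_le x z])
    have h2 := stableProfile_le_rpow_neg (d := d) (ρ := ‖y‖ / 4) (r := ‖z - y‖) hα hs0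
      hs1.le (by linarith) (by linarith [norm_sub_norm_le y z, norm_sub_rev y z])
    refine (mul_le_mul hw (mul_le_mul h1 h2 hB (by positivity)) (by positivity)
      (by positivity)).trans_eq ?_
    have e : (2 * ‖y‖) ^ ((d : ℝ) + α) *
        ((‖y‖ / 4) ^ (-((d : ℝ) + α)) * (‖y‖ / 4) ^ (-((d : ℝ) + α))) =
        32 ^ ((d : ℝ) + α) * ‖y‖ ^ (-((d : ℝ) + α)) := by
      rw [← mul_rpow (by positivity) (by positivity), rpow_neg (by positivity),
        ← inv_rpow (by positivity), ← mul_rpow (by positivity) (by positivity),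
        rpow_neg (by positivity), ← inv_rpow (by positivity),
        ← mul_rpow (by positivity) (by positivity)]
      congr 1
      field_simp
      norm_num
    linear_combination (2 * ((Set.Ioc (0 : ℝ) 1).indicator (fun r => r ^ (-(α + δ))) ‖z‖ +
            (1 + ‖z‖) ^ (-((d : ℝ) + α)))) * e

theorem exists_lintegral_duhamel_le {d : ℕ} (hd : 1 ≤ d) {α δ : ℝ} (hα : 0 < α) (hδ : 0 ≤ δ)
    (hαδ : α + δ < d) :
    ∃ K : ENNReal, K ≠ ⊤ ∧ ∀ x y : EuclideanSpace ℝ (Fin d), 1 ≤ ‖y‖ → ‖y‖ / 2 ≤ ‖x‖ →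
      ‖x‖ ≤ ‖y‖ → ∀ m : ℝ, (m = 1 ∨ 0 < ‖x - y‖ ∧ m = ‖x - y‖ ^ (-((d : ℝ) + α))) →
      ∀ s : ℝ, 0 < s → s < 1 →
      ∫⁻ z : EuclideanSpace ℝ (Fin d),
        ENNReal.ofReal (‖z‖ ^ (-α) * (1 + s ^ (δ / α) * ‖z‖ ^ (-δ)) *
          (stableProfile d α (1 - s) ‖x - z‖ * stableProfile d α s ‖z - y‖)) ≤
        K * (ENNReal.ofReal (‖y‖ ^ (-((d : ℝ) + α))) + ENNReal.ofReal (‖x‖ ^ (-α) * m)) := by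
  obtain ⟨K, hK, hKle⟩ := exists_lintegral_stableProfile_le d hα
  have hI := lintegral_indicator_norm_rpow_lt_top hd hαδ
  have hJ := lintegral_one_add_norm_lt_top d hα
  set I := ∫⁻ z : EuclideanSpace ℝ (Fin d),
    ENNReal.ofReal ((Set.Ioc (0 : ℝ) 1).indicator (fun r => r ^ (-(α + δ))) ‖z‖)
  set J := ∫⁻ z : EuclideanSpace ℝ (Fin d), ENNReal.ofReal ((1 + ‖z‖) ^ (-((d : ℝ) + α)))
  set c₁ : ℝ := 4 ^ α * (1 + 4 ^ δ) * (2 ^ ((d : ℝ) + α) + 2 ^ ((d : ℝ) / α)) with hc₁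
  set c₂ : ℝ := 2 * 32 ^ ((d : ℝ) + α) with hc₂
  have hc₁_nonneg : 0 ≤ c₁ := by positivity
  have hc₂_nonneg : 0 ≤ c₂ := by positivity
  refine ⟨ENNReal.ofReal c₁ * (K + K) + ENNReal.ofReal c₂ * (I + J), ?_, ?_⟩
  · simp [ENNReal.mul_eq_top, hK, hI.ne, hJ.ne]
  intro x y hy hyx hxy m hm s hs0 hs1
  have hm0 : 0 < m := by
    rcases hm with rfl | ⟨hc0, rfl⟩
    · norm_num
    · positivity
  have hs1' : 0 < 1 - s := by linarith
  have hind : Measurable (fun z : EuclideanSpace ℝ (Fin d) =>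
      ENNReal.ofReal ((Set.Ioc (0 : ℝ) 1).indicator (fun r => r ^ (-(α + δ))) ‖z‖)) := by
    have : Measurable ((Set.Ioc (0 : ℝ) 1).indicator (fun r => r ^ (-(α + δ)))) :=
      Measurable.indicator (by fun_prop) measurableSet_Ioc
    fun_prop
  have hmeas : Measurable (fun z : EuclideanSpace ℝ (Fin d) =>
      ENNReal.ofReal (stableProfile d α (1 - s) ‖x - z‖)) := by
    unfold stableProfile; fun_prop
  have hmeas' : Measurable (fun z : EuclideanSpace ℝ (Fin d) =>
      ENNReal.ofReal (stableProfile d α s ‖z - y‖)) := by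
    unfold stableProfile; fun_prop
  have hA : ∫⁻ z, ENNReal.ofReal (stableProfile d α (1 - s) ‖x - z‖) ≤ K :=
    (lintegral_sub_left_eq_self
      (fun z => ENNReal.ofReal (stableProfile d α (1 - s) ‖z‖)) x).trans_le (hKle _ hs1')
  have hB : ∫⁻ z, ENNReal.ofReal (stableProfile d α s ‖z - y‖) ≤ K :=
    (lintegral_sub_right_eq_self
      (fun z => ENNReal.ofReal (stableProfile d α s ‖z‖)) y).trans_le (hKle _ hs0)
  calc _ ≤ ∫⁻ z : EuclideanSpace ℝ (Fin d),
        (ENNReal.ofReal c₁ * ENNReal.ofReal (‖x‖ ^ (-α) * m) *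
          (ENNReal.ofReal (stableProfile d α (1 - s) ‖x - z‖) +
            ENNReal.ofReal (stableProfile d α s ‖z - y‖)) +
        ENNReal.ofReal c₂ * ENNReal.ofReal (‖y‖ ^ (-((d : ℝ) + α))) *
          (ENNReal.ofReal ((Set.Ioc (0 : ℝ) 1).indicator (fun r => r ^ (-(α + δ))) ‖z‖) +
            ENNReal.ofReal ((1 + ‖z‖) ^ (-((d : ℝ) + α))))) := by
        refine lintegral_mono fun z => ?_
        have hA := stableProfile_nonneg (d := d) (α := α) hs1'.le (norm_nonneg (x - z))
        have hB := stableProfile_nonneg (d := d) (α := α) hs0.le (norm_nonneg (z - y))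
        have hI : 0 ≤ (Set.Ioc (0 : ℝ) 1).indicator (fun r => r ^ (-(α + δ))) ‖z‖ :=
          Set.indicator_nonneg (fun r hr => rpow_nonneg hr.1.le _) _
        refine (ENNReal.ofReal_le_ofReal
          (duhamel_integrand_le hα hδ hs0 hs1 hy hyx hxy hm z)).trans_eq ?_
        rw [← hc₁, ← hc₂, ENNReal.ofReal_add (by positivity) (by positivity),
          ENNReal.ofReal_mul (mul_nonneg hc₁_nonneg (by positivity)), ENNReal.ofReal_mul hc₁_nonneg,
          ENNReal.ofReal_mul (mul_nonneg hc₂_nonneg (by positivity)), ENNReal.ofReal_mul hc₂_nonneg,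
          ENNReal.ofReal_add hA hB, ENNReal.ofReal_add hI (by positivity)]
    _ = ENNReal.ofReal c₁ * ENNReal.ofReal (‖x‖ ^ (-α) * m) *
          ((∫⁻ z, ENNReal.ofReal (stableProfile d α (1 - s) ‖x - z‖)) +
            ∫⁻ z, ENNReal.ofReal (stableProfile d α s ‖z - y‖)) +
        ENNReal.ofReal c₂ * ENNReal.ofReal (‖y‖ ^ (-((d : ℝ) + α))) * (I + J) := by
        rw [lintegral_add_left (by fun_prop), lintegral_const_mul' _ _ (by finiteness),
          lintegral_add_left hmeas, lintegral_const_mul' _ _ (by finiteness),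
          lintegral_add_left hind]
    _ ≤ ENNReal.ofReal c₁ * ENNReal.ofReal (‖x‖ ^ (-α) * m) * (K + K) +
        ENNReal.ofReal c₂ * ENNReal.ofReal (‖y‖ ^ (-((d : ℝ) + α))) * (I + J) := by
        gcongr
    _ = ENNReal.ofReal c₁ * (K + K) * ENNReal.ofReal (‖x‖ ^ (-α) * m) +
        ENNReal.ofReal c₂ * (I + J) * ENNReal.ofReal (‖y‖ ^ (-((d : ℝ) + α))) := by ring
    _ ≤ _ := by
        rw [mul_add (ENNReal.ofReal c₁ * (K + K) + _)]
        refine (add_comm _ _).trans_le (add_le_add ?_ ?_)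
        · exact mul_le_mul' le_add_self le_rfl
        · exact mul_le_mul' le_self_add le_rfl

/-- Bound on the Duhamel double integral for the difference of heat kernels at time `t = 1`
in the regime `|y| ≥ 1`, `|y|/2 ≤ |x| ≤ |y|`: it is controlled by
`C (|y|^{-(d+α)} + |x|^{-α} min(1, |x-y|^{-(d+α)}))` (in `ℝ≥0∞`, so that the minimum
equals `1` when `x = y`). -/
theorem duhamel_difference_bound (d : ℕ) (hd : 1 ≤ d) (α δ : ℝ) (hα0 : 0 < α)
    (hα2 : α < 2) (hαd : α < (d : ℝ)) (hδ0 : 0 ≤ δ) (hδ : δ ≤ ((d : ℝ) - α) / 2) :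
    ∃ C : ℝ, ∀ x y : EuclideanSpace ℝ (Fin d), 1 ≤ ‖y‖ → ‖y‖ / 2 ≤ ‖x‖ → ‖x‖ ≤ ‖y‖ →
      (∫⁻ s in Set.Ioo (0 : ℝ) 1, ∫⁻ z : EuclideanSpace ℝ (Fin d),
        ENNReal.ofReal (s ^ (-(d : ℝ) / α) * (1 - s) ^ (-(d : ℝ) / α) *
          ‖z‖ ^ (-α) * (1 + s ^ (δ / α) * ‖z‖ ^ (-δ)) *
          min 1 ((1 - s) ^ (1 + (d : ℝ) / α) / ‖x - z‖ ^ ((d : ℝ) + α)) *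
          min 1 (s ^ (1 + (d : ℝ) / α) / ‖z - y‖ ^ ((d : ℝ) + α))))
        ≤ ENNReal.ofReal C * (ENNReal.ofReal (‖y‖ ^ (-((d : ℝ) + α))) +
            ENNReal.ofReal (‖x‖ ^ (-α)) *
              min 1 ((ENNReal.ofReal ‖x - y‖) ^ (-((d : ℝ) + α)))) := by
  obtain ⟨K, hK, hKle⟩ := exists_lintegral_duhamel_le hd hα0 hδ0 (by linarith : α + δ < d)
  refine ⟨K.toReal, fun x y hy hyx hxy => ?_⟩
  obtain ⟨m, hm, hmin⟩ : ∃ m : ℝ, (m = 1 ∨ 0 < ‖x - y‖ ∧ m = ‖x - y‖ ^ (-((d : ℝ) + α))) ∧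
      ENNReal.ofReal m = min 1 ((ENNReal.ofReal ‖x - y‖) ^ (-((d : ℝ) + α))) := by
    rcases (norm_nonneg (x - y)).eq_or_lt with h | h
    · refine ⟨1, Or.inl rfl, ?_⟩
      rw [← h, ENNReal.ofReal_zero, ENNReal.zero_rpow_of_neg (by linarith)]
      simp
    · rw [ENNReal.ofReal_rpow_of_pos h]
      rcases le_total 1 (ENNReal.ofReal (‖x - y‖ ^ (-((d : ℝ) + α)))) with h1 | h1
      · exact ⟨1, Or.inl rfl, by rw [min_eq_left h1, ENNReal.ofReal_one]⟩
      · exact ⟨_, Or.inr ⟨h, rfl⟩, (min_eq_right h1).symm⟩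
  rw [ENNReal.ofReal_toReal hK, ← hmin, ← ENNReal.ofReal_mul (by positivity)]
  calc _ ≤ ∫⁻ s in Set.Ioo (0 : ℝ) 1, K * (ENNReal.ofReal (‖y‖ ^ (-((d : ℝ) + α))) +
        ENNReal.ofReal (‖x‖ ^ (-α) * m)) := by
        refine setLIntegral_mono measurable_const fun s hs => ?_
        refine Eq.trans_le ?_ (hKle x y hy hyx hxy m hm s hs.1 hs.2)
        refine lintegral_congr fun z => ?_
        congr 1
        unfold stableProfile
        ring
    _ = _ := by simp
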